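/- Let k ≥ 2 and for each j with 2 ≤ j ≤ k let (x_j, y_j) and (w_j, z_j) be pairs of nonnegative integers with x_j + y_j = w_j + z_j = j and {x_j, y_j} ≠ {w_j, z_j}. Then there exists a finite set A of nonnegative integers such that |x_jA - y_jA| > |w_jA - z_jA| for every 2 ≤ j ≤ k. -/

import Mathlib

open Finset Pointwise

/-- `itSum k A` is the k-fold sumset A + A + ⋯ + A (with `itSum 0 A = {0}`). -/
def itSum : ℕ → Finset ℤ → Finset ℤ
  | 0, _ => {0}
  | n+1, A => A + itSum n A

/-- `gDiff s d A = sA - dA`. -/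
def gDiff (s d : ℕ) (A : Finset ℤ) : Finset ℤ := itSum s A - itSum d A

section basics
variable {G : Type*} [AddCommGroup G] [DecidableEq G]

def gs : ℕ → Finset G → Finset G
  | 0, _ => {0}
  | n+1, A => A + gs n A

def gd (s d : ℕ) (A : Finset G) : Finset G := gs s A - gs d A

lemma gDiff_eq (s d : ℕ) (A : Finset ℤ) : gDiff s d A = gd s d A := by
  have h : ∀ n, itSum n A = gs n A := by
    intro n
    induction n with
    | zero => rfl
    | succ n ih => simp only [itSum, gs, ih]
  simp [gDiff, gd, h]

lemma gs_nonempty {A : Finset G} (hA : A.Nonempty) (n : ℕ) : (gs n A).Nonempty := by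
  induction n with
  | zero => exact singleton_nonempty 0
  | succ n ih => exact hA.add ih

lemma gd_nonempty {A : Finset G} (hA : A.Nonempty) (s d : ℕ) : (gd s d A).Nonempty :=
  (gs_nonempty hA s).sub (gs_nonempty hA d)

lemma gs_add (n : ℕ) (A B : Finset G) : gs n (A + B) = gs n A + gs n B := by
  induction n with
  | zero => simp [gs]
  | succ n ih => simp only [gs, ih]; exact add_add_add_comm _ _ _ _

lemma gd_add (s d : ℕ) (A B : Finset G) : gd s d (A + B) = gd s d A + gd s d B := by
  simp only [gd, gs_add]; exact add_sub_add_comm _ _ _ _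

lemma gs_image {H : Type*} [AddCommGroup H] [DecidableEq H] (f : G →+ H) (n : ℕ) (A : Finset G) :
    (gs n A).image f = gs n (A.image f) := by
  induction n with
  | zero => simp [gs]
  | succ n ih => simp only [gs, image_add, ih]

lemma gd_image {H : Type*} [AddCommGroup H] [DecidableEq H] (f : G →+ H) (s d : ℕ)
    (A : Finset G) : (gd s d A).image f = gd s d (A.image f) := by
  simp only [gd, ← gs_image]
  exact image_image₂_distrib (map_sub f)

lemma gs_prod {H : Type*} [AddCommGroup H] [DecidableEq H] (n : ℕ) (A : Finset G) (B : Finset H) :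
    gs n (A ×ˢ B) = gs n A ×ˢ gs n B := by
  induction n with
  | zero => rfl
  | succ n ih => simp only [gs, ih]; exact (product_add_product_comm _ _ _ _)

lemma gd_prod {H : Type*} [AddCommGroup H] [DecidableEq H] (s d : ℕ) (A : Finset G)
    (B : Finset H) : gd s d (A ×ˢ B) = gd s d A ×ˢ gd s d B := by
  simp only [gd, gs_prod]
  ext ⟨a, b⟩
  simp only [mem_sub, mem_product, Prod.exists, Prod.mk_sub_mk, Prod.mk.injEq]
  constructor
  · rintro ⟨a1, b1, ⟨h1, h2⟩, a2, b2, ⟨h3, h4⟩, h5, h6⟩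
    exact ⟨⟨a1, h1, a2, h3, h5⟩, ⟨b1, h2, b2, h4, h6⟩⟩
  · rintro ⟨⟨a1, h1, a2, h3, h5⟩, ⟨b1, h2, b2, h4, h6⟩⟩
    exact ⟨a1, b1, ⟨h1, h2⟩, a2, b2, ⟨h3, h4⟩, h5, h6⟩

lemma gs_pi {κ : Type*} [Fintype κ] [DecidableEq κ] (n : ℕ) (A : Finset G) :
    gs n (Fintype.piFinset fun _ : κ => A) = Fintype.piFinset fun _ : κ => gs n A := by
  induction n with
  | zero => ext f; simp [gs, funext_iff]
  | succ n ih => simp only [gs, ih, Fintype.piFinset_add]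

lemma gd_pi {κ : Type*} [Fintype κ] [DecidableEq κ] (s d : ℕ) (A : Finset G) :
    gd s d (Fintype.piFinset fun _ : κ => A) = Fintype.piFinset fun _ : κ => gd s d A := by
  simp only [gd, gs_pi, Fintype.piFinset_sub]

lemma gd_swap (s d : ℕ) (A : Finset G) : gd d s A = - gd s d A := by
  simp only [gd, neg_sub]

lemma sum_const_gs {κ : Type*} [DecidableEq κ] (S : Finset κ) (A : Finset G) :
    ∑ _k ∈ S, A = gs S.card A := by
  induction S using Finset.induction with
  | empty => simp [gs]; rfl
  | insert a S ha ih => rw [sum_insert ha, card_insert_of_notMem ha, ih]; rfl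

lemma gs_neg (n : ℕ) (A : Finset G) : gs n (-A) = - gs n A := by
  induction n with
  | zero => simp [gs]
  | succ n ih => simp only [gs, ih, neg_add]

def sg {H : Type*} [Neg H] (b : Bool) (x : H) : H := if b then x else -x

/-- membership in `sA-dA` by signed sums over an index type. -/
lemma mem_gd_iff {κ : Type*} [Fintype κ] [DecidableEq κ] (σ : κ → Bool) (A : Finset G) (g : G) :
    g ∈ gd (univ.filter fun k => σ k = true).card (univ.filter fun k => σ k = false).card A ↔
      ∃ a : κ → G, (∀ k, a k ∈ A) ∧ ∑ k, sg (σ k) (a k) = g := by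
  have h : gd (univ.filter fun k => σ k = true).card (univ.filter fun k => σ k = false).card A
      = ∑ k, sg (σ k) A := by
    simp only [sg]
    rw [sum_ite, sum_const_gs, sum_const_gs, gs_neg]
    simp only [gd, sub_eq_add_neg, Bool.not_eq_true]
  rw [h, ← mem_coe, coe_sum, Set.mem_finsetSum]
  constructor
  · rintro ⟨b, hb, rfl⟩
    refine ⟨fun k => sg (σ k) (b k), fun k => ?_, ?_⟩
    · have := hb (mem_univ k)
      cases hk : σ k <;> simp_all [sg]
    · refine sum_congr rfl fun k _ => ?_
      cases hk : σ k <;> simp [sg, hk]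
  · rintro ⟨a, ha, rfl⟩
    refine ⟨fun k => sg (σ k) (a k), fun {k} _ => ?_, rfl⟩
    have := ha k
    cases hk : σ k <;> simp_all [sg]

end basics

section construction
set_option linter.unusedSectionVars false

abbrev HH := ZMod 16

def RR : Finset HH := {0, 1, 3}

lemma sg_sg_rr : ∀ (b : Bool) (u : HH), (∀ ρ ∈ RR, ∃ c : Bool, ∃ ρ' ∈ RR,
    sg b ρ - u = sg c ρ') → u = 0 := by decide

lemma sg_one_rr : ∀ (b c : Bool), ∀ ρ' ∈ RR, sg b (1 : HH) = sg c ρ' → b = c := by decide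

lemma hh_split : ∀ (b c : Bool) (g : HH), ∃ g1 g2 : HH, g1 ≠ 1 ∧ g1 ≠ -1 ∧ g2 ≠ 1 ∧ g2 ≠ -1 ∧
    sg b g1 + sg c g2 = g := by decide

variable {ι : Type} [Fintype ι] [DecidableEq ι]

/-- the condition on the "big" type. -/
def TT (w : ℕ) (f : Option ι → HH × HH) : Prop :=
  ∀ (τ : Option ι → Bool) (ρ : ι → HH), (∀ i, ρ i ∈ RR) →
    (univ.filter fun k => τ k = true).card = w →
    ¬ (sg (τ none) (f none).1 = 1 ∧
      ∀ i, sg (τ none) (f (some i)).1 + sg (τ (some i)) (ρ i) = 0)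

/-- elements of the construction, of type `k`. -/
def tyP (w : ℕ) (k : Option ι) (f : Option ι → HH × HH) : Prop :=
  match k with
  | none => (∀ i, (f (some i)).2 = 0) ∧ TT w f
  | some i => (∀ k, k ≠ some i → f k = 0) ∧ (f (some i)).1 ∈ RR

open Classical in
noncomputable def AA (ι : Type) [Fintype ι] [DecidableEq ι] (w : ℕ) :
    Finset (Option ι → HH × HH) :=
  univ.filter fun f => ∃ k, tyP w k f

lemma mem_AA (w : ℕ) (f : Option ι → HH × HH) : f ∈ AA ι w ↔ ∃ k, tyP w k f := by
  simp [AA]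

lemma TT_of_ne (w : ℕ) (f : Option ι → HH × HH) (h1 : (f none).1 ≠ 1) (h2 : (f none).1 ≠ -1) :
    TT w f := by
  intro τ ρ _ _ ⟨h, _⟩
  cases hb : τ none
  · simp only [sg, hb] at h
    apply h2; rw [← h]; simp
  · simp only [sg, hb] at h
    exact h1 (by simpa using h)

lemma zero_mem_AA (w : ℕ) : (0 : Option ι → HH × HH) ∈ AA ι w := by
  rw [mem_AA]
  refine ⟨none, fun i => rfl, TT_of_ne w _ ?_ ?_⟩ <;> simp only [Pi.zero_apply, Prod.fst_zero] <;>
    decide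

lemma exists_sign (κ : Type) [Fintype κ] [DecidableEq κ] (s d : ℕ)
    (h : s + d = Fintype.card κ) : ∃ σ : κ → Bool,
      (univ.filter fun k => σ k = true).card = s ∧
      (univ.filter fun k => σ k = false).card = d := by
  obtain ⟨S, -, hS⟩ := exists_subset_card_eq (s := (univ : Finset κ)) (n := s)
    (by rw [card_univ]; omega)
  refine ⟨fun k => decide (k ∈ S), ?_, ?_⟩
  · simpa using hS
  · have : (univ.filter fun k => decide (k ∈ S) = false) = Sᶜ := by ext; simp
    rw [this, card_compl, hS]; omega

lemma card_option_filter (σ : Option ι → Bool) :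
    (univ.filter fun k => σ k = true).card =
      (if σ none = true then 1 else 0) + (univ.filter fun i => σ (some i) = true).card := by
  simp only [card_filter, Fintype.sum_option]

lemma card_filter_false {κ : Type} [Fintype κ] (σ : κ → Bool) :
    (univ.filter fun k => σ k = true).card + (univ.filter fun k => σ k = false).card =
      Fintype.card κ := by
  have := card_filter_add_card_filter_not (s := (univ : Finset κ)) (fun k => σ k = true)
  simpa using this

lemma AA_not_full (w z : ℕ) (h : w + z = Fintype.card (Option ι)) :
    gd w z (AA ι w) ≠ univ := by
  intro hu
  obtain ⟨σ, hs, hd⟩ := exists_sign (Option ι) w z h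
  have hm : (fun k => if k = none then (1, 1) else (0, 1) : Option ι → HH × HH) ∈
      gd w z (AA ι w) := by rw [hu]; exact mem_univ _
  rw [← hs, ← hd, mem_gd_iff σ, hs] at hm
  obtain ⟨a, ha, hsum⟩ := hm
  simp only [mem_AA] at ha
  choose t ht using ha
  -- t surjective
  have h0 : ∀ k l, t l ≠ k → (a l k).2 = 0 := by
    intro k l hl
    have := ht l
    cases htl : t l with
    | none =>
      rw [htl] at this hl
      cases k with
      | none => exact absurd rfl hl
      | some i => exact this.1 i
    | some i =>
      rw [htl] at this hl
      rw [this.1 k (fun h => hl h.symm)]; rfl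
  have hsg2 : ∀ (b : Bool) (f : Option ι → HH × HH) k, (sg b f k).2 = sg b (f k).2 := by
    intro b f k; cases b <;> simp [sg]
  have hsg1 : ∀ (b : Bool) (f : Option ι → HH × HH) k, (sg b f k).1 = sg b (f k).1 := by
    intro b f k; cases b <;> simp [sg]
  have hsurj : Function.Surjective t := by
    intro k
    by_contra hcon
    push Not at hcon
    have h2 := congrArg Prod.snd (congrFun hsum k)
    rw [Finset.sum_apply, Prod.snd_sum, sum_eq_zero] at h2
    · by_cases hk : k = none <;> simp [hk] at h2 <;> exact absurd h2 (by decide)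
    · intro l _
      rw [hsg2, h0 k l (hcon l)]; cases σ l <;> simp [sg]
  have hbij : Function.Bijective t := Finite.surjective_iff_bijective.1 hsurj
  let e := Equiv.ofBijective t hbij
  have hte : ∀ k, t (e.symm k) = k := fun k => Equiv.ofBijective_apply_symm_apply t hbij k
  have hsum' : ∑ k, sg (σ (e.symm k)) (a (e.symm k)) =
      (fun k => if k = none then (1, 1) else (0, 1) : Option ι → HH × HH) := by
    rw [← hsum]; exact Equiv.sum_comp e.symm (fun l => sg (σ l) (a l))
  have hT := ht (e.symm none)
  rw [hte] at hT
  have hI : ∀ i, tyP w (some i) (a (e.symm (some i))) := fun i => by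
    have := ht (e.symm (some i)); rwa [hte] at this
  refine hT.2 (fun k => σ (e.symm k)) (fun i => (a (e.symm (some i)) (some i)).1)
    (fun i => (hI i).2) ?_ ⟨?_, ?_⟩
  · rw [← hs]
    apply card_bij (fun k _ => e.symm k)
    · intro k hk; simpa using hk
    · intro k _ l _ hkl; exact e.symm.injective hkl
    · intro l hl; exact ⟨e l, by simpa using hl, by simp⟩
  · have h1 := congrArg Prod.fst (congrFun hsum' none)
    rw [Finset.sum_apply, Prod.fst_sum, Fintype.sum_option, sum_eq_zero, hsg1] at h1
    · simpa using h1
    · intro i _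
      rw [hsg1, (hI i).1 none (by simp)]
      cases σ (e.symm (some i)) <;> simp [sg]
  · intro i
    have h1 := congrArg Prod.fst (congrFun hsum' (some i))
    rw [Finset.sum_apply, Prod.fst_sum, Fintype.sum_option, sum_eq_single i, hsg1, hsg1] at h1
    · simpa using h1
    · intro l _ hl
      rw [hsg1, (hI l).1 (some i) (by simpa using hl.symm)]
      cases σ (e.symm (some l)) <;> simp [sg]
    · simp

lemma sg_sg {H : Type*} [AddGroup H] (b : Bool) (x : H) : sg b (sg b x) = x := by
  cases b <;> simp [sg]

/-- the small elements. -/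
def sm (i : ι) (p : HH × HH) : Option ι → HH × HH := fun k => if k = some i then p else 0

lemma sm_mem (w : ℕ) (i : ι) (p : HH × HH) (hp : p.1 ∈ RR) : sm i p ∈ AA ι w := by
  rw [mem_AA]
  refine ⟨some i, fun k hk => by simp [sm, hk], by simpa [sm] using hp⟩

lemma sum_sm (σ : ι → Bool) (p : ι → HH × HH) (k : Option ι) :
    (∑ i, sg (σ i) (sm i (p i))) k = match k with | none => 0 | some i => sg (σ i) (p i) := by
  rw [Finset.sum_apply]
  have h : ∀ i k, sg (σ i) (sm i (p i)) k = if k = some i then sg (σ i) (p i) else 0 := by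
    intro i k
    cases σ i <;> by_cases hk : k = some i <;> simp [sg, sm, hk]
  simp only [h]
  cases k with
  | none => simp
  | some l => simp

lemma AA_full (x y w z : ℕ) (h : x + y = Fintype.card (Option ι))
    (h' : w + z = Fintype.card (Option ι)) (hx : 1 ≤ x)
    (hxw : x ≠ w) (hxz : x ≠ z) : gd x y (AA ι w) = univ := by
  rw [Fintype.card_option] at h h'
  obtain ⟨σ, hs, hd⟩ := exists_sign ι (x - 1) y (by omega)
  rw [eq_univ_iff_forall]
  intro f
  let σ' : Option ι → Bool := fun k => match k with | none => true | some i => σ i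
  have hs' : (univ.filter fun k => σ' k = true).card = x := by
    rw [card_option_filter]
    have : (univ.filter fun i => σ' (some i) = true).card = x - 1 := hs
    rw [this]; simp only [σ', if_true]; omega
  have hd' : (univ.filter fun k => σ' k = false).card = y := by
    have := card_filter_false σ'
    rw [Fintype.card_option] at this
    omega
  rw [← hs', ← hd', mem_gd_iff σ']
  -- find ρ
  have key : ∃ ρ : ι → HH, (∀ i, ρ i ∈ RR) ∧
      TT w (fun k => match k with
        | none => f none
        | some i => ((f (some i)).1 - sg (σ i) (ρ i), 0)) := by
    by_contra hcon
    push Not at hcon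
    simp only [TT] at hcon
    push Not at hcon
    have hz : ∀ i, (f (some i)).1 = 0 := by
      intro i
      apply sg_sg_rr (σ i)
      intro r hr
      obtain ⟨τ, ρ', hρ', -, -, h2⟩ := hcon (fun _ => r) (fun _ => hr)
      have h3 := h2 i
      refine ⟨τ none == τ (some i), ρ' i, hρ' i, ?_⟩
      cases hb : τ none <;> cases hc : τ (some i) <;> simp [hb, hc, sg] at h3 ⊢ <;>
        grind
    obtain ⟨τ, ρ', hρ', hτ, -, h2⟩ := hcon (fun _ => 1) (fun _ => by decide)
    have hσ : ∀ i, σ i = (τ none == τ (some i)) := by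
      intro i
      apply sg_one_rr _ _ (ρ' i) (hρ' i)
      have h3 := h2 i
      rw [hz] at h3
      cases hb : τ none <;> cases hc : τ (some i) <;> simp [hb, hc, sg] at h3 ⊢ <;>
        grind
    rw [card_option_filter] at hτ
    simp only [hσ] at hs
    cases hb : τ none
    · simp [hb] at hτ hs
      have := card_filter_false (fun i => τ (some i))
      omega
    · simp [hb] at hτ hs
      omega
  obtain ⟨ρ, hρ, hT⟩ := key
  refine ⟨fun k => match k with
    | none => fun k => match k with
        | none => f none
        | some i => ((f (some i)).1 - sg (σ i) (ρ i), 0)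
    | some i => sm i (ρ i, sg (σ i) (f (some i)).2), ?_, ?_⟩
  · intro k
    cases k with
    | none => rw [mem_AA]; exact ⟨none, fun i => rfl, hT⟩
    | some i => exact sm_mem w i _ (hρ i)
  · rw [Fintype.sum_option]
    funext k
    rw [Pi.add_apply]
    simp only [σ']
    rw [sum_sm]
    cases k with
    | none => simp [sg]
    | some i =>
      ext
      · cases hb : σ i <;> simp [sg, hb]
      · cases hb : σ i <;> simp [sg, hb]

lemma AA_full_succ (s d w : ℕ) (h : s + d = Fintype.card (Option ι) + 1) :
    gd s d (AA ι w) = univ := by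
  obtain ⟨σ, hs, hd⟩ := exists_sign (Option (Option ι)) s d (by rw [Fintype.card_option]; exact h)
  rw [eq_univ_iff_forall]
  intro f
  rw [← hs, ← hd, mem_gd_iff σ]
  obtain ⟨g1, g2, h1, h2, h3, h4, h5⟩ := hh_split (σ none) (σ (some none)) (f none).1
  refine ⟨fun k => match k with
    | none => fun k => match k with
        | none => (g1, sg (σ none) (f none).2)
        | some i => (sg (σ none) (f (some i)).1, 0)
    | some none => fun k => match k with
        | none => (g2, 0)
        | some i => 0
    | some (some i) => sm i (0, sg (σ (some (some i))) (f (some i)).2), ?_, ?_⟩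
  · intro k
    match k with
    | none => rw [mem_AA]; exact ⟨none, fun i => rfl, TT_of_ne _ _ h1 h2⟩
    | some none => rw [mem_AA]; exact ⟨none, fun i => rfl, TT_of_ne _ _ h3 h4⟩
    | some (some i) => exact sm_mem w i _ (show (0 : HH) ∈ RR by decide)
  · rw [Fintype.sum_option, Fintype.sum_option]
    funext k
    rw [Pi.add_apply, Pi.add_apply]
    rw [sum_sm (fun i => σ (some (some i)))]
    cases k with
    | none =>
      ext
      · rw [← h5]; cases σ none <;> cases σ (some none) <;> simp [sg]
      · cases σ none <;> cases σ (some none) <;> simp [sg]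
    | some i =>
      ext
      · cases ha : σ none <;> cases hb : σ (some none) <;> cases hc : σ (some (some i)) <;>
          simp [sg, hc]
      · cases ha : σ none <;> cases hb : σ (some none) <;> cases hc : σ (some (some i)) <;>
          simp [sg, hc]

lemma gs_mono {G : Type*} [AddCommGroup G] [DecidableEq G] {A : Finset G} (h0 : 0 ∈ A)
    {m n : ℕ} (h : m ≤ n) : gs m A ⊆ gs n A := by
  induction n, h using Nat.le_induction with
  | base => exact Subset.refl _
  | succ n _ ih =>
    intro g hg
    exact mem_add.2 ⟨0, h0, g, ih hg, zero_add g⟩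

lemma gd_mono {G : Type*} [AddCommGroup G] [DecidableEq G] {A : Finset G} (h0 : 0 ∈ A)
    {m n p q : ℕ} (h : m ≤ n) (h' : p ≤ q) : gd m p A ⊆ gd n q A :=
  sub_subset_sub (gs_mono h0 h) (gs_mono h0 h')

lemma AA_full_gt (s d w : ℕ) (h : Fintype.card (Option ι) < s + d) :
    gd s d (AA ι w) = univ := by
  obtain ⟨s', d', hs, hd, hsd⟩ : ∃ s' d', s' ≤ s ∧ d' ≤ d ∧
      s' + d' = Fintype.card (Option ι) + 1 :=
    ⟨min s (Fintype.card (Option ι) + 1), Fintype.card (Option ι) + 1 -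
      min s (Fintype.card (Option ι) + 1), by omega, by omega, by omega⟩
  have := gd_mono (zero_mem_AA (ι := ι) w) hs hd
  rw [AA_full_succ s' d' w hsd] at this
  exact univ_subset_iff.1 this

theorem exists_piece (j x y w z : ℕ) (hj : 2 ≤ j) (h : x + y = j) (h' : w + z = j)
    (hne : ¬ ((x = w ∧ y = z) ∨ (x = z ∧ y = w))) :
    ∃ (G : Type) (_ : AddCommGroup G) (_ : Fintype G) (_ : DecidableEq G) (A : Finset G),
      A.Nonempty ∧ (gd w z A).card < (gd x y A).card ∧
      ∀ s d, j < s + d → (gd s d A).card = Fintype.card G := by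
  have hc : Fintype.card (Option (Fin (j - 1))) = j := by simp; omega
  refine ⟨Option (Fin (j - 1)) → HH × HH, inferInstance, inferInstance, inferInstance,
    AA (Fin (j - 1)) w, ⟨0, zero_mem_AA w⟩, ?_, ?_⟩
  · have h1 : (gd x y (AA (Fin (j - 1)) w)).card = Fintype.card (Option (Fin (j - 1)) → HH × HH) := by
      by_cases hx : 1 ≤ x
      · rw [AA_full x y w z (by omega) (by omega) hx (by omega) (by omega), card_univ]
      · rw [gd_swap, card_neg, AA_full y x w z (by omega) (by omega) (by omega) (by omega)
          (by omega), card_univ]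
    rw [h1]
    exact (card_lt_iff_ne_univ _).2 (AA_not_full w z (by omega))
  · intro s d hsd
    rw [AA_full_gt s d w (by omega), card_univ]

end construction

section combine

lemma exists_pow_beats (a b c d : ℕ) (hc : 0 < c) (hbd : b < d) :
    ∃ n : ℕ, a * b ^ n < c * d ^ n := by
  have hd : 0 < d := by omega
  have hlt : (b : ℝ) / d < 1 := by
    rw [div_lt_one (by positivity)]; exact_mod_cast hbd
  obtain ⟨n, hn⟩ := exists_pow_lt_of_lt_one (show (0 : ℝ) < 1 / (a + 1) by positivity) hlt
  refine ⟨n, ?_⟩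
  rw [div_pow, div_lt_div_iff₀ (by positivity) (by positivity)] at hn
  have h1 : b ^ n * (a + 1) < 1 * d ^ n := by exact_mod_cast hn
  have h2 : 1 * d ^ n ≤ c * d ^ n := Nat.mul_le_mul_right _ hc
  nlinarith [Nat.zero_le (b ^ n)]

theorem combine (k : ℕ) (x y w z : ℕ → ℕ)
    (hxy : ∀ j, 2 ≤ j → j ≤ k → x j + y j = j)
    (hwz : ∀ j, 2 ≤ j → j ≤ k → w j + z j = j)
    (hne : ∀ j, 2 ≤ j → j ≤ k →
      ¬ ((x j = w j ∧ y j = z j) ∨ (x j = z j ∧ y j = w j))) (n : ℕ) :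
    ∃ (G : Type) (_ : AddCommGroup G) (_ : Fintype G) (_ : DecidableEq G) (A : Finset G),
      A.Nonempty ∧ ∀ j, 2 ≤ j → j ≤ k → k < j + n →
        (gd (w j) (z j) A).card < (gd (x j) (y j) A).card := by
  induction n with
  | zero =>
    exact ⟨Unit, inferInstance, inferInstance, inferInstance, {0}, singleton_nonempty _,
      fun j _ _ _ => by omega⟩
  | succ n ih =>
    obtain ⟨G, i1, i2, i3, A, hA, h⟩ := ih
    by_cases hj : n ≤ k ∧ 2 ≤ k - n
    · obtain ⟨hnk, hj2⟩ := hj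
      set j := k - n with hjdef
      have hjk : j ≤ k := by omega
      obtain ⟨H, i4, i5, i6, B, hB, hlt, hfull⟩ :=
        exists_piece j (x j) (y j) (w j) (z j) hj2 (hxy j hj2 hjk) (hwz j hj2 hjk) (hne j hj2 hjk)
      obtain ⟨m, hm⟩ := exists_pow_beats (gd (w j) (z j) A).card (gd (w j) (z j) B).card
        (gd (x j) (y j) A).card (gd (x j) (y j) B).card (gd_nonempty hA _ _).card_pos hlt
      refine ⟨G × (Fin m → H), inferInstance, inferInstance, inferInstance,
        A ×ˢ (Fintype.piFinset fun _ : Fin m => B),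
        hA.product (Fintype.piFinset_nonempty.2 fun _ => hB), ?_⟩
      intro i hi2 hik hin
      simp only [gd_prod, gd_pi, card_product, Fintype.card_piFinset_const]
      by_cases hij : i = j
      · rw [hij]; exact hm
      · have hji : j < i := by omega
        rw [hfull (x i) (y i) (by rw [hxy i hi2 hik]; exact hji),
          hfull (w i) (z i) (by rw [hwz i hi2 hik]; exact hji)]
        refine Nat.mul_lt_mul_of_pos_right (h i hi2 hik (by omega)) ?_
        have : 0 < Fintype.card H := Fintype.card_pos
        positivity
    · exact ⟨G, i1, i2, i3, A, hA, fun j h1 h2 h3 => h j h1 h2 (by omega)⟩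

end combine

section lift
set_option linter.unusedSectionVars false

lemma gs_Icc (n : ℕ) (L : ℕ) : gs n (Icc (0 : ℤ) L) = Icc (0 : ℤ) (n * L) := by
  induction n with
  | zero => simp [gs]
  | succ n ih =>
    rw [gs, ih]
    ext a
    simp only [mem_add, mem_Icc]
    have hnL : (0 : ℤ) ≤ n * L := by positivity
    push_cast
    constructor
    · rintro ⟨b, hb, c, hc, rfl⟩; constructor <;> linarith [hb.1, hb.2, hc.1, hc.2]
    · rintro ⟨h1, h2⟩
      refine ⟨min a L, ⟨by positivity, min_le_right _ _⟩, a - min a L, ⟨?_, ?_⟩, by ring⟩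
      · linarith [min_le_left a (L : ℤ)]
      · rcases min_cases a (L : ℤ) with ⟨h, _⟩ | ⟨h, _⟩ <;> rw [h] <;> linarith

lemma gd_Icc (s d : ℕ) (L : ℕ) : gd s d (Icc (0 : ℤ) L) = Icc (-(d * L) : ℤ) (s * L) := by
  rw [gd, gs_Icc, gs_Icc]
  ext a
  simp only [mem_sub, mem_Icc]
  have hsL : (0 : ℤ) ≤ s * L := by positivity
  have hdL : (0 : ℤ) ≤ d * L := by positivity
  constructor
  · rintro ⟨b, hb, c, hc, rfl⟩; constructor <;> linarith [hb.1, hb.2, hc.1, hc.2]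
  · rintro ⟨h1, h2⟩
    refine ⟨max a 0, ⟨le_max_right _ _, max_le h2 hsL⟩, max a 0 - a, ⟨?_, ?_⟩, by ring⟩
    · linarith [le_max_left a 0]
    · rcases max_cases a 0 with ⟨h, _⟩ | ⟨h, _⟩ <;> rw [h] <;> linarith

lemma gs_subset {G : Type*} [AddCommGroup G] [DecidableEq G] {A B : Finset G} (h : A ⊆ B) (n : ℕ) :
    gs n A ⊆ gs n B := by
  induction n with
  | zero => exact Subset.refl _
  | succ n ih => exact add_subset_add h ih

lemma gd_subset {G : Type*} [AddCommGroup G] [DecidableEq G] {A B : Finset G} (h : A ⊆ B)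
    (s d : ℕ) : gd s d A ⊆ gd s d B := sub_subset_sub (gs_subset h s) (gs_subset h d)

variable {ι : Type} [Fintype ι] [DecidableEq ι]

/-- reduction. -/
def red (m : ι → ℕ) : (ι → ℤ) →+ (∀ i, ZMod (m i)) where
  toFun v i := (v i : ZMod (m i))
  map_zero' := by funext i; simp
  map_add' u v := by funext i; simp

def scal (m : ι → ℕ) : (ι → ℤ) →+ (ι → ℤ) where
  toFun v i := m i * v i
  map_zero' := by funext i; simp
  map_add' u v := by funext i; simp [mul_add]

def vv (m : ι → ℕ) (a : ∀ i, ZMod (m i)) : ι → ℤ := fun i => ((a i).val : ℤ)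

noncomputable def lft (m : ι → ℕ) (A : Finset (∀ i, ZMod (m i))) (L : ℕ) : Finset (ι → ℤ) :=
  A.image (vv m) + (Fintype.piFinset fun _ => Icc (0 : ℤ) L).image (scal m)

lemma red_vv (m : ι → ℕ) (hm : ∀ i, 0 < m i) (a : ∀ i, ZMod (m i)) : red m (vv m a) = a := by
  funext i
  have : NeZero (m i) := ⟨(hm i).ne'⟩
  simp [red, vv]

lemma red_scal (m : ι → ℕ) (v : ι → ℤ) : red m (scal m v) = 0 := by
  funext i
  simp [red, scal]

lemma image_red_image_vv (m : ι → ℕ) (hm : ∀ i, 0 < m i) (A : Finset (∀ i, ZMod (m i))) :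
    (A.image (vv m)).image (red m) = A := by
  rw [image_image]
  have : red m ∘ vv m = id := funext fun a => red_vv m hm a
  simp [this]

lemma lower (m : ι → ℕ) (hm : ∀ i, 0 < m i) (A : Finset (∀ i, ZMod (m i))) (L s d : ℕ) :
    (gd s d A).card * ((s + d) * L + 1) ^ Fintype.card ι ≤ (gd s d (lft m A L)).card := by
  rw [lft, gd_add, ← gd_image, gd_pi, gd_Icc]
  have h1 : (gd s d A).card * ((s + d) * L + 1) ^ Fintype.card ι =
      (gd s d A ×ˢ (Fintype.piFinset fun _ : ι => Icc (-(d * L) : ℤ) (s * L))).card := by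
    rw [card_product, Fintype.card_piFinset, prod_const, card_univ]
    congr 2
    rw [Int.card_Icc]
    have : (s * L + 1 - -(d * L) : ℤ) = (((s + d) * L + 1 : ℕ) : ℤ) := by push_cast; ring
    rw [this, Int.toNat_natCast]
  rw [h1]
  have h2 : ∀ q : (∀ i, ZMod (m i)), ∃ v : ι → ℤ, q ∈ gd s d A →
      v ∈ gd s d (A.image (vv m)) ∧ red m v = q := by
    intro q
    by_cases hq : q ∈ gd s d A
    · have hq' := hq
      rw [← image_red_image_vv m hm A, ← gd_image] at hq'
      obtain ⟨v, hv, rfl⟩ := mem_image.1 hq'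
      exact ⟨v, fun _ => ⟨hv, rfl⟩⟩
    · exact ⟨0, fun h => absurd h hq⟩
  choose base hbase using h2
  apply card_le_card_of_injOn (fun p => base p.1 + scal m p.2)
  · rintro ⟨q, t⟩ hp
    obtain ⟨hq, ht⟩ := mem_product.1 (mem_coe.1 hp)
    exact mem_coe.2 (add_mem_add (hbase q hq).1 (mem_image_of_mem _ ht))
  · rintro ⟨q, t⟩ hp ⟨q', t'⟩ hp' heq
    obtain ⟨hq, ht⟩ := mem_product.1 (mem_coe.1 hp)
    obtain ⟨hq', ht'⟩ := mem_product.1 (mem_coe.1 hp')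
    simp only at heq hq hq'
    have hqq : q = q' := by
      have := congrArg (red m) heq
      rwa [map_add, map_add, red_scal, red_scal, add_zero, add_zero, (hbase q hq).2,
        (hbase q' hq').2] at this
    subst hqq
    have := add_left_cancel heq
    have htt : t = t' := by
      funext i
      have h := congrFun this i
      have hmi : (m i : ℤ) ≠ 0 := by exact_mod_cast (hm i).ne'
      exact mul_left_cancel₀ hmi h
    rw [htt]

lemma lft_image_red (m : ι → ℕ) (hm : ∀ i, 0 < m i) (A : Finset (∀ i, ZMod (m i))) (L : ℕ) :
    (lft m A L).image (red m) = A := by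
  rw [lft, image_add, image_red_image_vv m hm]
  have : ((Fintype.piFinset fun _ : ι => Icc (0 : ℤ) L).image (scal m)).image (red m) = {0} := by
    ext g
    simp only [mem_image, mem_singleton]
    constructor
    · rintro ⟨_, ⟨v, _, rfl⟩, rfl⟩; exact red_scal m v
    · rintro rfl
      exact ⟨_, ⟨0, by simp, rfl⟩, red_scal m 0⟩
  rw [this, add_singleton]; simp

lemma lft_range (m : ι → ℕ) (hm : ∀ i, 0 < m i) (A : Finset (∀ i, ZMod (m i))) (L : ℕ)
    (v : ι → ℤ) (hv : v ∈ lft m A L) (i : ι) : 0 ≤ v i ∧ v i ≤ ((m i * (L + 1) : ℕ) : ℤ) := by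
  rw [lft, mem_add] at hv
  obtain ⟨b, hb, c, hc, rfl⟩ := hv
  obtain ⟨a, ha, rfl⟩ := mem_image.1 hb
  obtain ⟨t, ht, rfl⟩ := mem_image.1 hc
  have ht' := mem_Icc.1 (Fintype.mem_piFinset.1 ht i)
  have : NeZero (m i) := ⟨(hm i).ne'⟩
  have hval : ((a i).val : ℤ) < m i := by exact_mod_cast ZMod.val_lt (a i)
  have hval0 : (0 : ℤ) ≤ ((a i).val : ℤ) := by positivity
  have hm0 : (0 : ℤ) < m i := by exact_mod_cast hm i
  have e : (vv m a + scal m t) i = ((a i).val : ℤ) + m i * t i := rfl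
  rw [e]
  push_cast
  constructor
  · have := mul_nonneg hm0.le ht'.1; linarith
  · have := mul_le_mul_of_nonneg_left ht'.2 hm0.le; linarith

lemma upper (m : ι → ℕ) (hm : ∀ i, 0 < m i) (A : Finset (∀ i, ZMod (m i))) (L s d : ℕ) :
    (gd s d (lft m A L)).card ≤
      (gd s d A).card * ((s + d) * (L + 1) + 1) ^ Fintype.card ι := by
  have h1 : (gd s d A).card * ((s + d) * (L + 1) + 1) ^ Fintype.card ι =
      (gd s d A ×ˢ (Fintype.piFinset fun _ : ι => Icc (-(d * (L + 1)) : ℤ) (s * (L + 1)))).card := by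
    rw [card_product, Fintype.card_piFinset, prod_const, card_univ]
    congr 2
    rw [Int.card_Icc]
    have : (s * (L + 1) + 1 - -(d * (L + 1)) : ℤ) = (((s + d) * (L + 1) + 1 : ℕ) : ℤ) := by
      push_cast; ring
    rw [this, Int.toNat_natCast]
  rw [h1]
  apply card_le_card_of_injOn (fun v => (red m v, fun i => v i / m i))
  · intro v hv
    have hv := mem_coe.1 hv
    refine mem_coe.2 (mem_product.2 ⟨?_, Fintype.mem_piFinset.2 fun i => mem_Icc.2 ?_⟩)
    · rw [← lft_image_red m hm A L, ← gd_image]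
      exact mem_image_of_mem _ hv
    · have h2 : v i ∈ gd s d (Icc (0 : ℤ) ((m i * (L + 1) : ℕ) : ℤ)) := by
        have h3 : (gd s d (lft m A L)).image (Pi.evalAddMonoidHom (fun _ : ι => ℤ) i) ⊆
            gd s d (Icc (0 : ℤ) ((m i * (L + 1) : ℕ) : ℤ)) := by
          rw [gd_image]
          apply gd_subset
          intro a ha
          obtain ⟨u, hu, rfl⟩ := mem_image.1 ha
          exact mem_Icc.2 (lft_range m hm A L u hu i)
        exact h3 (mem_image_of_mem (Pi.evalAddMonoidHom (fun _ : ι => ℤ) i) hv)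
      rw [gd_Icc, mem_Icc] at h2
      have hm0 : (0 : ℤ) < m i := by exact_mod_cast hm i
      push_cast at h2
      simp only
      constructor
      · rw [Int.le_ediv_iff_mul_le hm0]; nlinarith [h2.1]
      · apply Int.ediv_le_of_le_mul hm0; nlinarith [h2.2]
  · intro u hu v hv huv
    simp only [Prod.mk.injEq] at huv
    funext i
    have h1 := congrFun huv.1 i
    have h2 := congrFun huv.2 i
    have h3 : u i % m i = v i % m i := (ZMod.intCast_eq_intCast_iff' _ _ _).1 h1
    rw [← Int.emod_add_mul_ediv (u i) (m i), ← Int.emod_add_mul_ediv (v i) (m i), h3]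
    rw [h2]

lemma compare (D D' r j L N : ℕ) (hD : D' < D) (hN : D ≤ N) (hL : r * N ≤ L) (hj : 1 ≤ j) :
    D' * (j * (L + 1) + 1) ^ r < D * (j * L + 1) ^ r := by
  set X : ℝ := j * (L + 1) + 1 with hX
  have hXpos : 0 < X := by positivity
  have hjR : (1 : ℝ) ≤ j := by exact_mod_cast hj
  have hB := one_add_mul_le_pow (a := -(j / X : ℝ)) (by
    have : (j : ℝ) / X ≤ 1 := by
      rw [div_le_one hXpos, hX]; nlinarith [show (0 : ℝ) ≤ L by positivity]
    linarith) r
  have e : (1 + -(j / X : ℝ)) = (j * L + 1) / X := by field_simp; rw [hX]; ring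
  rw [e, div_pow] at hB
  have hXr : 0 < X ^ r := by positivity
  rw [le_div_iff₀ hXr] at hB
  have hkey : (D' : ℝ) < D * (1 + r * -(j / X)) := by
    have h1 : (D' : ℝ) + 1 ≤ D := by exact_mod_cast hD
    have h2 : (D : ℝ) ≤ N := by exact_mod_cast hN
    have h3 : (r : ℝ) * N ≤ L := by exact_mod_cast hL
    have h4 : (D : ℝ) * (r * (j / X)) < 1 := by
      have : (D : ℝ) * (r * (j / X)) = D * r * j / X := by ring
      rw [this, div_lt_one hXpos, hX]
      have h5 : (D : ℝ) * r ≤ L := by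
        calc (D : ℝ) * r ≤ N * r := by gcongr
          _ ≤ L := by linarith
      nlinarith
    linarith
  have : (D' : ℝ) * X ^ r < D * (j * L + 1) ^ r := by
    calc (D' : ℝ) * X ^ r < D * (1 + r * -(j / X)) * X ^ r := by gcongr
      _ = D * ((1 + r * -(j / X)) * X ^ r) := by ring
      _ ≤ D * (j * L + 1) ^ r := by gcongr
  rw [hX] at this
  exact_mod_cast this

lemma exists_inj (n : ℕ) (S : Finset (Fin n → ℤ)) : ∃ ψ : (Fin n → ℤ) →+ ℤ, Set.InjOn ψ S := by
  let P : (Fin n → ℤ) → Polynomial ℤ := fun v => ∑ i : Fin n, Polynomial.C (v i) * Polynomial.X ^ (i : ℕ)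
  have hP : ∀ v, P v = 0 → v = 0 := by
    intro v hv
    funext i
    have := congrArg (fun p => Polynomial.coeff p (i : ℕ)) hv
    simp only [P, Polynomial.finsetSum_coeff, Polynomial.coeff_C_mul_X_pow, Polynomial.coeff_zero] at this
    rw [sum_eq_single i] at this
    · simpa using this
    · intro b _ hb
      rw [if_neg]; intro h; exact hb (Fin.ext h.symm)
    · simp
  let Q : Polynomial ℤ := ∏ p ∈ (S ×ˢ S).filter (fun p => p.1 ≠ p.2), P (p.1 - p.2)
  have hQ : Q ≠ 0 := by
    rw [prod_ne_zero_iff]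
    intro p hp h
    exact (mem_filter.1 hp).2 (sub_eq_zero.1 (hP _ h))
  obtain ⟨M, hM⟩ : ∃ M : ℤ, Q.eval M ≠ 0 := by
    by_contra hcon
    push Not at hcon
    exact hQ (Polynomial.funext fun r => by rw [hcon r, Polynomial.eval_zero])
  refine ⟨{ toFun := fun v => ∑ i, v i * M ^ (i : ℕ), map_zero' := by simp,
            map_add' := fun u v => by simp [add_mul, sum_add_distrib] }, ?_⟩
  intro u hu v hv huv
  by_contra hne
  apply hM
  rw [Polynomial.eval_prod]
  apply prod_eq_zero (i := (u, v))
  · simp only [mem_filter, mem_product]; exact ⟨⟨hu, hv⟩, hne⟩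
  · simp only [P, Polynomial.eval_finsetSum, Polynomial.eval_mul, Polynomial.eval_C,
      Polynomial.eval_pow, Polynomial.eval_X, Pi.sub_apply, sub_mul, sum_sub_distrib]
    simp only [AddMonoidHom.coe_mk, ZeroHom.coe_mk] at huv
    rw [huv, sub_self]

lemma exists_inj' (S : Finset (ι → ℤ)) : ∃ ψ : (ι → ℤ) →+ ℤ, Set.InjOn ψ S := by
  let e := Fintype.equivFin ι
  let F : (ι → ℤ) →+ (Fin (Fintype.card ι) → ℤ) :=
    { toFun := fun v i => v (e.symm i), map_zero' := rfl, map_add' := fun _ _ => rfl }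
  have hF : Function.Injective F := by
    intro u v h
    funext i
    have := congrFun h (e i)
    simpa [F] using this
  obtain ⟨ψ, hψ⟩ := exists_inj _ (S.image F)
  refine ⟨ψ.comp F, ?_⟩
  intro u hu v hv huv
  exact hF (hψ (by simpa using ⟨u, hu, rfl⟩) (by simpa using ⟨v, hv, rfl⟩) huv)

lemma card_gd_image_of_inj {G H : Type*} [AddCommGroup G] [DecidableEq G] [AddCommGroup H]
    [DecidableEq H] (f : G →+ H) (s d : ℕ) (A : Finset G) (hf : Set.InjOn f (gd s d A)) :
    (gd s d (A.image f)).card = (gd s d A).card := by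
  rw [← gd_image, card_image_of_injOn hf]

lemma gs_singleton {G : Type*} [AddCommGroup G] [DecidableEq G] (c : G) (n : ℕ) :
    ∃ e, gs n {c} = {e} := by
  induction n with
  | zero => exact ⟨0, rfl⟩
  | succ n ih => obtain ⟨e, he⟩ := ih; exact ⟨c + e, by rw [gs, he, singleton_add_singleton]⟩

lemma card_gd_translate {G : Type*} [AddCommGroup G] [DecidableEq G] (c : G) (s d : ℕ)
    (A : Finset G) : (gd s d (A + {c})).card = (gd s d A).card := by
  obtain ⟨e, he⟩ := gs_singleton c s
  obtain ⟨e', he'⟩ := gs_singleton c d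
  rw [gd_add]
  have : gd s d {c} = {e - e'} := by rw [gd, he, he', singleton_sub_singleton]
  rw [this, card_add_singleton]

end lift

theorem stmt_19 (k : ℕ) (hk : 2 ≤ k) (x y w z : ℕ → ℕ)
    (hxy : ∀ j, 2 ≤ j → j ≤ k → x j + y j = j)
    (hwz : ∀ j, 2 ≤ j → j ≤ k → w j + z j = j)
    (hne : ∀ j, 2 ≤ j → j ≤ k →
      ¬ ((x j = w j ∧ y j = z j) ∨ (x j = z j ∧ y j = w j))) :
    ∃ A : Finset ℤ, (∀ a ∈ A, 0 ≤ a) ∧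
      ∀ j, 2 ≤ j → j ≤ k →
        (gDiff (x j) (y j) A).card > (gDiff (w j) (z j) A).card := by
  classical
  obtain ⟨G, i1, i2, i3, A, hA, h⟩ := combine k x y w z hxy hwz hne k
  obtain ⟨ι, _, m, hm, ⟨e⟩⟩ := AddCommGroup.equiv_directSum_zmod_of_finite' G
  let e' : G ≃+ (∀ i, ZMod (m i)) := e.trans (DirectSum.addEquivProd _)
  have hm0 : ∀ i, 0 < m i := fun i => lt_trans one_pos (hm i)
  let B : Finset (∀ i, ZMod (m i)) := A.image e'.toAddMonoidHom
  have hB : ∀ s d, (gd s d B).card = (gd s d A).card := fun s d =>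
    card_gd_image_of_inj e'.toAddMonoidHom s d A (e'.injective.injOn)
  let L := Fintype.card ι * Fintype.card G
  let C := lft m B L
  have hC : ∀ j, 2 ≤ j → j ≤ k → (gd (w j) (z j) C).card < (gd (x j) (y j) C).card := by
    intro j h2 hjk
    have hu := upper m hm0 B L (w j) (z j)
    have hl := lower m hm0 B L (x j) (y j)
    rw [hB, hwz j h2 hjk] at hu
    rw [hB, hxy j h2 hjk] at hl
    exact lt_of_le_of_lt hu (lt_of_lt_of_le (compare _ _ _ j L (Fintype.card G)
      (h j h2 hjk (by omega)) (card_le_univ _) le_rfl (by omega)) hl)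
  obtain ⟨ψ, hψ⟩ := exists_inj' ((range (k + 1)).biUnion fun j =>
    gd (x j) (y j) C ∪ gd (w j) (z j) C)
  obtain ⟨c, hc⟩ : ∃ c : ℤ, ∀ a ∈ C.image ψ, -c ≤ a := by
    obtain ⟨b, hb⟩ := (C.image ψ).bddBelow
    exact ⟨-b, fun a ha => by rw [neg_neg]; exact hb ha⟩
  refine ⟨C.image ψ + {c}, ?_, ?_⟩
  · intro a ha
    rw [mem_add] at ha
    obtain ⟨b, hb, c', hc', rfl⟩ := ha
    rw [mem_singleton.1 hc']
    linarith [hc b hb]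
  · intro j h2 hjk
    rw [gDiff_eq, gDiff_eq, card_gd_translate, card_gd_translate,
      card_gd_image_of_inj, card_gd_image_of_inj]
    · exact hC j h2 hjk
    · refine hψ.mono ?_
      intro v hv
      exact mem_coe.2 (mem_biUnion.2 ⟨j, mem_range.2 (by omega), mem_union_right _ hv⟩)
    · refine hψ.mono ?_
      intro v hv
      exact mem_coe.2 (mem_biUnion.2 ⟨j, mem_range.2 (by omega), mem_union_left _ hv⟩)
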